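/- Let 1 < p < ∞ with Hölder conjugate p', assume the uniform summability ∑_{i≥0} sup_{x∈X} ‖P^{(i)}_x‖_{ℓ^{p'}(X)} < ∞, and let g ∈ D^p(Γ). If the boundary value of g for the simple random walk is a constant function (lim_{n→∞} ∑_y P^{(n)}_x(y) g(y) is the same constant for all x), then the class of g in the reduced ℓ^p-cohomology in degree one is trivial, i.e. g lies in the D^p-closure of ℓ^p(X) + ℝ·1. -/

import Mathlib

open scoped BigOperators ENNReal NNReal
open Filter Topology

/-- `f` is `p`-summable (`f ∈ ℓ^p`), for a real exponent `0 < p < ∞`. -/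
def lpMem {ι : Type*} (p : ℝ) (f : ι → ℝ) : Prop := Summable fun i => |f i| ^ p

/-- The `ℓ^q`-norm with exponent `q ∈ [1,∞]`, valued in `ℝ≥0∞`. -/
noncomputable def lpENorm {ι : Type*} (q : ℝ≥0∞) (f : ι → ℝ) : ℝ≥0∞ :=
  if q = ⊤ then ⨆ i, (‖f i‖₊ : ℝ≥0∞)
  else (∑' i, (‖f i‖₊ : ℝ≥0∞) ^ q.toReal) ^ (1 / q.toReal)

/-- A bounded real-valued function. -/
def BoundedFun {ι : Type*} (f : ι → ℝ) : Prop := ∃ M : ℝ, ∀ i, |f i| ≤ M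

/-- A graph of bounded (locally finite) valency: each vertex has a finite
set of neighbours, the adjacency is symmetric and there are no loops. -/
structure LFGraph (X : Type*) where
  nbr : X → Finset X
  symm : ∀ x y : X, y ∈ nbr x ↔ x ∈ nbr y
  loopless : ∀ x : X, x ∉ nbr x

namespace LFGraph

variable {X : Type*}

/-- Adjacency. -/
def Adj (G : LFGraph X) (x y : X) : Prop := y ∈ G.nbr x

/-- Connectivity of the graph. -/
def Conn (G : LFGraph X) : Prop := ∀ x y : X, Relation.ReflTransGen G.Adj x y

/-- The valency is bounded by `D`. -/
def BddVal (G : LFGraph X) (D : ℕ) : Prop := ∀ x : X, (G.nbr x).card ≤ D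

/-- The set of oriented edges. -/
abbrev Edge (G : LFGraph X) : Type _ := {e : X × X // e.2 ∈ G.nbr e.1}

/-- The gradient `∇g(x,y) = g(y) - g(x)` of a function on the vertices,
as a function on oriented edges. -/
def grad (G : LFGraph X) (g : X → ℝ) (e : G.Edge) : ℝ := g e.1.2 - g e.1.1

/-- `g ∈ D^p(Γ)`: the gradient of `g` is in `ℓ^p(E)` (`p` finite). -/
def MemDp (G : LFGraph X) (p : ℝ) (g : X → ℝ) : Prop := lpMem p (G.grad g)

/-- The `ℓ^p(E)`-norm of the gradient of `g`. -/
noncomputable def gradNorm (G : LFGraph X) (p : ℝ) (g : X → ℝ) : ℝ :=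
  (∑' e : G.Edge, |G.grad g e| ^ p) ^ (1 / p)

/-- The `D^p`-distance between `g` and `h`, with basepoint `e0`:
`‖∇(g-h)‖_{ℓ^p(E)} + |g(e0) - h(e0)|`. -/
noncomputable def dpDist (G : LFGraph X) (p : ℝ) (e0 : X) (g h : X → ℝ) : ℝ :=
  G.gradNorm p (fun x => g x - h x) + |g e0 - h e0|

/-- `g` belongs to the `D^p`-closure of `ℓ^p(X) + ℝ·1`, i.e. the class of `g`
in the degree one reduced `ℓ^p`-cohomology is trivial. -/
def InClos (G : LFGraph X) (p : ℝ) (e0 : X) (g : X → ℝ) : Prop :=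
  ∀ ε : ℝ, 0 < ε → ∃ (f : X → ℝ) (c : ℝ), lpMem p f ∧
    G.MemDp p (fun x => g x - (f x + c)) ∧
    G.dpDist p e0 g (fun x => f x + c) < ε

/-- `g` belongs to the `D^p`-closure of `ℓ^p(X)` (no constants). -/
def InClosLp (G : LFGraph X) (p : ℝ) (e0 : X) (g : X → ℝ) : Prop :=
  ∀ ε : ℝ, 0 < ε → ∃ f : X → ℝ, lpMem p f ∧
    G.MemDp p (fun x => g x - f x) ∧
    G.dpDist p e0 g f < ε

open Classical in
/-- The number of (oriented) boundary edges of a finite set `A` of vertices. -/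
noncomputable def bdry (G : LFGraph X) (A : Finset X) : ℕ :=
  ∑ x ∈ A, ((G.nbr x).filter fun y => y ∉ A).card

/-- The `d`-dimensional isoperimetric profile `IS_d`. -/
def ISdim (G : LFGraph X) (d : ℝ) : Prop :=
  ∃ κ : ℝ, 0 < κ ∧ ∀ A : Finset X, A.Nonempty →
    (A.card : ℝ) ^ (1 - 1 / d) ≤ κ * (G.bdry A : ℝ)

/-- The strong isoperimetric profile `IS_ω`. -/
def ISomega (G : LFGraph X) : Prop :=
  ∃ κ : ℝ, 0 < κ ∧ ∀ A : Finset X, A.Nonempty →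
    (A.card : ℝ) ≤ κ * (G.bdry A : ℝ)

/-- `h` is harmonic: at every vertex, the average of `h` over the
neighbours equals the value of `h`. -/
def Harmonic (G : LFGraph X) (h : X → ℝ) : Prop :=
  ∀ x : X, ∑ y ∈ G.nbr x, h y = ((G.nbr x).card : ℝ) * h x

/-- The graph is Liouville: every bounded harmonic function is constant. -/
def Liouville (G : LFGraph X) : Prop :=
  ∀ h : X → ℝ, G.Harmonic h → BoundedFun h → ∀ x y : X, h x = h y

open Classical in
/-- `walk G n x y` is the probability `P^{(n)}_x(y)` that the simple random
walk started at `x` is at `y` at time `n`. -/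
noncomputable def walk (G : LFGraph X) : ℕ → X → X → ℝ
  | 0, x, y => if y = x then 1 else 0
  | n + 1, x, y => (∑ z ∈ G.nbr x, walk G n z y) / ((G.nbr x).card : ℝ)

/-- `avg G n g x = ∑_y P^{(n)}_x(y) g(y)`, the expected value of `g` after `n`
steps of the simple random walk started at `x`. -/
noncomputable def avg (G : LFGraph X) (n : ℕ) (g : X → ℝ) (x : X) : ℝ :=
  ∑' y, G.walk n x y * g y

/-- The Markov operator of the simple random walk: average over the neighbours. -/
noncomputable def pAvg (G : LFGraph X) (f : X → ℝ) (x : X) : ℝ :=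
  (∑ y ∈ G.nbr x, f y) / ((G.nbr x).card : ℝ)

/-- Reachability in exactly `n` steps. -/
def reachN (G : LFGraph X) : ℕ → X → X → Prop
  | 0, x, y => y = x
  | n + 1, x, y => ∃ z ∈ G.nbr x, reachN G n z y

/-- The graph distance (the smallest `n` such that `y` is reachable from `x`
in `n` steps). -/
noncomputable def gdist (G : LFGraph X) (x y : X) : ℕ :=
  sInf {n : ℕ | G.reachN n x y}

/-- `f` is a quasi-isometry between the connected graphs `G` and `H`. -/
def QI {X Y : Type*} (G : LFGraph X) (H : LFGraph Y) (f : X → Y) : Prop :=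
  G.Conn ∧ H.Conn ∧ ∃ Λ C : ℝ, 1 ≤ Λ ∧ 0 ≤ C ∧
    (∀ x x' : X, (H.gdist (f x) (f x') : ℝ) ≤ Λ * (G.gdist x x') + C) ∧
    (∀ x x' : X, (G.gdist x x' : ℝ) ≤ Λ * (H.gdist (f x) (f x')) + C) ∧
    ∀ y : Y, ∃ x : X, (H.gdist (f x) y : ℝ) ≤ C

/-- Reachability avoiding the finite set `F`. -/
def reachAvoid (G : LFGraph X) (F : Finset X) : X → X → Prop :=
  Relation.ReflTransGen fun a b => b ∈ G.nbr a ∧ a ∉ F ∧ b ∉ F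

/-- The graph has at most one end: for every finite set `F` of vertices,
the complement of `F` has at most one infinite connected component. -/
def AtMostOneEnd (G : LFGraph X) : Prop :=
  ∀ F : Finset X, ∀ x y : X, x ∉ F → y ∉ F →
    {z | G.reachAvoid F x z}.Infinite → {z | G.reachAvoid F y z}.Infinite →
    G.reachAvoid F x y

end LFGraph

/-- The Cayley graph of a group with respect to a finite symmetric generating
set `S` not containing the identity: the neighbours of `x` are the `s * x`, `s ∈ S`. -/
def cayley {Γ : Type*} [Group Γ] [DecidableEq Γ] (S : Finset Γ)
    (hsym : ∀ s ∈ S, s⁻¹ ∈ S) (h1 : (1 : Γ) ∉ S) : LFGraph Γ where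
  nbr x := S.image fun s => s * x
  symm := by
    intro x y
    simp only [Finset.mem_image]
    constructor
    · rintro ⟨s, hs, rfl⟩
      exact ⟨s⁻¹, hsym s hs, by group⟩
    · rintro ⟨s, hs, rfl⟩
      exact ⟨s⁻¹, hsym s hs, by group⟩
  loopless := by
    intro x hx
    rw [Finset.mem_image] at hx
    obtain ⟨s, hs, hsx⟩ := hx
    have hs1 : s = 1 := by
      have h' : s * x = 1 * x := by rw [one_mul]; exact hsx
      exact mul_right_cancel h'
    exact h1 (hs1 ▸ hs)

/-- The ball of radius `n` in the word metric given by `S`. -/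
def cball {Γ : Type*} [Group Γ] [DecidableEq Γ] (S : Finset Γ) : ℕ → Finset Γ
  | 0 => {1}
  | n + 1 => cball S n ∪ (cball S n).biUnion fun x => S.image fun s => s * x

/-- Amenability of a group, via the Følner condition. -/
def Amenable (Γ : Type*) [Group Γ] [DecidableEq Γ] : Prop :=
  ∀ (T : Finset Γ) (ε : ℝ), 0 < ε → ∃ F : Finset Γ, F.Nonempty ∧
    ∀ t ∈ T, (((F.image fun x => t * x) \ F).card : ℝ) ≤ ε * (F.card : ℝ)
namespace LFGraph

variable {X : Type*}

lemma walk_support_finite (G : LFGraph X) (n : ℕ) (x : X) :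
    (Function.support (G.walk n x)).Finite := by
  induction n generalizing x with
  | zero =>
    refine (Set.finite_singleton x).subset fun y hy => ?_
    by_contra hne
    exact hy (if_neg hne)
  | succ n ih =>
    refine ((G.nbr x).finite_toSet.biUnion fun z _ => ih z).subset fun y hy => ?_
    have hsum : ∑ z ∈ G.nbr x, G.walk n z y ≠ 0 := fun h0 => hy (by simp [walk, h0])
    obtain ⟨z, hz, hzy⟩ := Finset.exists_ne_zero_of_sum_ne_zero hsum
    exact Set.mem_biUnion (Finset.mem_coe.2 hz) hzy

lemma summable_walk_mul (G : LFGraph X) (n : ℕ) (f : X → ℝ) (x : X) :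
    Summable fun y => G.walk n x y * f y :=
  summable_of_hasFiniteSupport <| (G.walk_support_finite n x).subset
    (Function.support_mul_subset_left _ _)

lemma avg_eq_iterate (G : LFGraph X) (n : ℕ) (f : X → ℝ) : G.avg n f = G.pAvg^[n] f := by
  induction n with
  | zero =>
    ext x
    simp [avg, walk]
  | succ n ih =>
    ext x
    rw [Function.iterate_succ_apply', ← ih]
    simp only [avg, pAvg, walk]
    rw [← Summable.tsum_finsetSum fun z _ => G.summable_walk_mul n f z, ← tsum_div_const]
    congr 1 with y
    rw [div_mul_eq_mul_div, Finset.sum_mul]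

lemma avg_sub (G : LFGraph X) (n : ℕ) (f h : X → ℝ) :
    G.avg n (fun x => f x - h x) = fun x => G.avg n f x - G.avg n h x := by
  ext x
  simp only [avg, mul_sub]
  exact (G.summable_walk_mul n f x).tsum_sub (G.summable_walk_mul n h x)

lemma avg_pAvg (G : LFGraph X) (n : ℕ) (f : X → ℝ) : G.avg n (G.pAvg f) = G.avg (n + 1) f := by
  rw [avg_eq_iterate, avg_eq_iterate, Function.iterate_succ_apply]

lemma sum_avg_sub_pAvg (G : LFGraph X) (n : ℕ) (g : X → ℝ) (x : X) :
    ∑ i ∈ Finset.range n, G.avg i (fun x => g x - G.pAvg g x) x = g x - G.avg n g x := by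
  simp only [avg_sub, avg_pAvg]
  rw [Finset.sum_range_sub']
  simp [avg_eq_iterate]

lemma pAvg_tendsto_cofinite (G : LFGraph X) {f : X → ℝ} (hf : Tendsto f cofinite (𝓝 0)) :
    Tendsto (G.pAvg f) cofinite (𝓝 0) := by
  rw [Metric.tendsto_nhds] at hf ⊢
  intro ε hε
  have hfin := hf ε hε
  rw [Filter.eventually_cofinite] at hfin ⊢
  refine (hfin.biUnion fun y _ => (G.nbr y).finite_toSet).subset fun x hx => ?_
  by_contra hcon
  apply hx
  have hsmall : ∀ y ∈ G.nbr x, ‖f y‖ < ε := by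
    intro y hy
    by_contra hy'
    refine hcon (Set.mem_biUnion (x := y) ?_ (Finset.mem_coe.2 ((G.symm x y).1 hy)))
    simpa using hy'
  rw [dist_zero_right, pAvg]
  rcases (G.nbr x).eq_empty_or_nonempty with h0 | h0
  · simpa [h0] using hε
  · have hc : (0 : ℝ) < (G.nbr x).card := by exact_mod_cast h0.card_pos
    rw [norm_div, Real.norm_natCast, div_lt_iff₀ hc]
    calc ‖∑ y ∈ G.nbr x, f y‖ ≤ ∑ y ∈ G.nbr x, ‖f y‖ := norm_sum_le _ _
      _ < ∑ _y ∈ G.nbr x, ε := Finset.sum_lt_sum_of_nonempty h0 hsmall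
      _ = ε * (G.nbr x).card := by simp [mul_comm]

lemma avg_tendsto_cofinite (G : LFGraph X) {f : X → ℝ} (hf : Tendsto f cofinite (𝓝 0)) (n : ℕ) :
    Tendsto (G.avg n f) cofinite (𝓝 0) := by
  rw [avg_eq_iterate]
  induction n with
  | zero => exact hf
  | succ n ih =>
    rw [Function.iterate_succ_apply']
    exact G.pAvg_tendsto_cofinite ih

/-- In the absence of isolated vertices, the Laplacian of a function of `D^p` is in `ℓ^p`. -/
lemma MemDp.lpMem_sub_pAvg {G : LFGraph X} (hne : ∀ x, (G.nbr x).Nonempty) {p : ℝ} (hp : 0 < p)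
    {g : X → ℝ} (hg : G.MemDp p g) : lpMem p fun x => g x - G.pAvg g x := by
  let φ : (Σ x, {y // y ∈ G.nbr x}) → G.Edge := fun s => ⟨(s.1, s.2.1), s.2.2⟩
  have hφ : Function.Injective φ := by
    rintro ⟨x, y, hy⟩ ⟨x', y', hy'⟩ h
    simp only [φ, Subtype.mk.injEq, Prod.mk.injEq] at h
    obtain ⟨rfl, rfl⟩ := h
    rfl
  have hs : Summable fun x => ∑ y ∈ G.nbr x, |g y - g x| ^ p := by
    have hsig := (hg.comp_injective hφ).sigma
    refine hsig.congr fun x => ?_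
    rw [tsum_fintype]
    exact Finset.sum_coe_sort (G.nbr x) fun y => |g y - g x| ^ p
  refine Summable.of_nonneg_of_le (fun x => by positivity) (fun x => ?_) hs
  obtain ⟨y, hy, hmax⟩ := Finset.exists_max_image (G.nbr x) (fun y => |g y - g x|) (hne x)
  have hc : (0 : ℝ) < (G.nbr x).card := by exact_mod_cast (hne x).card_pos
  have hle : |g x - G.pAvg g x| ≤ |g y - g x| := by
    have heq : g x - G.pAvg g x = -((∑ z ∈ G.nbr x, (g z - g x)) / (G.nbr x).card) := by
      rw [pAvg, Finset.sum_sub_distrib, Finset.sum_const, nsmul_eq_mul]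
      field_simp
      ring
    rw [heq, abs_neg, abs_div, Nat.abs_cast, div_le_iff₀ hc]
    calc |∑ z ∈ G.nbr x, (g z - g x)| ≤ ∑ z ∈ G.nbr x, |g z - g x| :=
          Finset.abs_sum_le_sum_abs _ _
      _ ≤ ∑ _z ∈ G.nbr x, |g y - g x| := Finset.sum_le_sum hmax
      _ = |g y - g x| * (G.nbr x).card := by simp [mul_comm]
  calc |g x - G.pAvg g x| ^ p ≤ |g y - g x| ^ p := Real.rpow_le_rpow (abs_nonneg _) hle hp.le
    _ ≤ ∑ y ∈ G.nbr x, |g y - g x| ^ p :=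
      Finset.single_le_sum (f := fun y => |g y - g x| ^ p) (fun z _ => by positivity) hy

lemma enorm_avg_le (G : LFGraph X) {p : ℝ} {q : ℝ≥0∞} (hq : q ≠ ⊤)
    (hpq : p.HolderConjugate q.toReal) (n : ℕ) (u : X → ℝ) (x : X) :
    ‖G.avg n u x‖ₑ ≤ lpENorm q (G.walk n x) * (∑' y, ‖u y‖ₑ ^ p) ^ (1 / p) := by
  have hfin := G.walk_support_finite n x
  have havg : G.avg n u x = ∑ y ∈ hfin.toFinset, G.walk n x y * u y := by
    refine tsum_eq_sum fun y hy => ?_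
    have hy0 : G.walk n x y = 0 := by simpa using hy
    rw [hy0, zero_mul]
  rw [havg, lpENorm, if_neg hq]
  calc ‖∑ y ∈ hfin.toFinset, G.walk n x y * u y‖ₑ
      ≤ ∑ y ∈ hfin.toFinset, ‖G.walk n x y * u y‖ₑ := enorm_sum_le _ _
    _ = ∑ y ∈ hfin.toFinset, ‖G.walk n x y‖ₑ * ‖u y‖ₑ := by simp only [enorm_mul]
    _ ≤ (∑ y ∈ hfin.toFinset, ‖G.walk n x y‖ₑ ^ q.toReal) ^ (1 / q.toReal)
        * (∑ y ∈ hfin.toFinset, ‖u y‖ₑ ^ p) ^ (1 / p) :=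
      ENNReal.inner_le_Lp_mul_Lq _ _ _ hpq.symm
    _ ≤ _ := by
      have hp0 := hpq.nonneg
      have hq0 := hpq.symm.nonneg
      exact mul_le_mul' (ENNReal.rpow_le_rpow (ENNReal.sum_le_tsum _) (by positivity))
        (ENNReal.rpow_le_rpow (ENNReal.sum_le_tsum _) (by positivity))

/-- A function of `D^p` that tends to the constant `c` at infinity has trivial class in the
reduced `ℓ^p`-cohomology. -/
lemma MemDp.inClos_of_tendsto_cofinite {G : LFGraph X} {p : ℝ} (hp : 0 < p) {g : X → ℝ}
    (hg : G.MemDp p g) {c : ℝ} (hc : Tendsto g cofinite (𝓝 c)) (e0 : X) : G.InClos p e0 g := by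
  let t : ℝ → X → ℝ := fun δ x => max (-δ) (min (g x - c) δ)
  have ht0 : ∀ x, Tendsto (fun δ => t δ x) (𝓝[>] 0) (𝓝 0) := by
    intro x
    have hcont : Continuous fun δ => t δ x := by fun_prop
    have h0 : t 0 x = 0 := by simp [t]
    simpa only [h0] using (hcont.tendsto 0).mono_left nhdsWithin_le_nhds
  have hle : ∀ δ (e : G.Edge), |G.grad (t δ) e| ^ p ≤ |G.grad g e| ^ p := by
    intro δ e
    refine Real.rpow_le_rpow (abs_nonneg _) ?_ hp.le
    calc |t δ e.1.2 - t δ e.1.1|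
        ≤ |min (g e.1.2 - c) δ - min (g e.1.1 - c) δ| := by
          simpa only [t, max_comm (-δ)] using
            abs_max_sub_max_le_abs (min (g e.1.2 - c) δ) (min (g e.1.1 - c) δ) (-δ)
      _ ≤ max |(g e.1.2 - c) - (g e.1.1 - c)| |δ - δ| := abs_min_sub_min_le_max _ _ _ _
      _ = |G.grad g e| := by simp [grad]
  have hnorm : Tendsto (fun δ => G.gradNorm p (t δ)) (𝓝[>] 0) (𝓝 0) := by
    have hsum : Tendsto (fun δ => ∑' e, |G.grad (t δ) e| ^ p) (𝓝[>] 0)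
        (𝓝 (∑' _ : G.Edge, (0 : ℝ))) := by
      refine tendsto_tsum_of_dominated_convergence hg (fun e => ?_)
        (Eventually.of_forall fun δ e => ?_)
      · have h := (((ht0 e.1.2).sub (ht0 e.1.1)).abs).rpow_const (p := p) (Or.inr hp.le)
        simpa [grad, Real.zero_rpow hp.ne'] using h
      · rw [Real.norm_of_nonneg (by positivity)]
        exact hle δ e
    have h := hsum.rpow_const (p := 1 / p) (Or.inr (by positivity))
    simpa [gradNorm, Real.zero_rpow (inv_ne_zero hp.ne')] using h
  intro ε hε
  have hlim : Tendsto (fun δ => G.gradNorm p (t δ) + |t δ e0|) (𝓝[>] 0) (𝓝 0) := by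
    simpa using hnorm.add (ht0 e0).abs
  obtain ⟨δ, hδ, hδ0⟩ := ((hlim.eventually_lt_const hε).and self_mem_nhdsWithin).exists
  have hsub : ∀ x, g x - ((g x - c - t δ x) + c) = t δ x := fun x => by ring
  refine ⟨fun x => g x - c - t δ x, c, ?_, ?_, ?_⟩
  · have hnear := hc.eventually (Metric.ball_mem_nhds c hδ0)
    rw [Filter.eventually_cofinite] at hnear
    refine summable_of_hasFiniteSupport (hnear.subset fun x hx hball => hx ?_)
    rw [Real.dist_eq, abs_lt] at hball
    have hx0 : g x - c - t δ x = 0 := by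
      simp only [t]
      rw [min_eq_left hball.2.le, max_eq_right hball.1.le, sub_self]
    simp only [hx0, abs_zero, Real.zero_rpow hp.ne']
  · simp only [hsub]
    exact Summable.of_nonneg_of_le (fun e => by positivity) (hle δ) hg
  · simpa only [dpDist, hsub] using hδ

lemma Conn.nbr_nonempty {G : LFGraph X} (hconn : G.Conn) [Nontrivial X] (x : X) :
    (G.nbr x).Nonempty := by
  obtain ⟨y, hy⟩ := exists_ne x
  rcases (hconn x y).cases_head with h | ⟨z, hz, -⟩
  · exact absurd h.symm hy
  · exact ⟨z, hz⟩

/-- Under uniform summability of the `ℓ^{p'}`-norms of the walk distributions, a function of `D^p`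
with constant boundary value tends to this constant at infinity. -/
lemma MemDp.tendsto_cofinite {G : LFGraph X} (hne : ∀ x, (G.nbr x).Nonempty)
    {p : ℝ} {q : ℝ≥0∞} (hq : q ≠ ⊤) (hpq : p.HolderConjugate q.toReal)
    (hsum : ∑' i : ℕ, ⨆ x : X, lpENorm q (G.walk i x) ≠ ⊤)
    {g : X → ℝ} (hg : G.MemDp p g) {c : ℝ}
    (hbv : ∀ x : X, Tendsto (fun n => G.avg n g x) atTop (𝓝 c)) :
    Tendsto g cofinite (𝓝 c) := by
  have hp := hpq.pos
  set u : X → ℝ := fun x => g x - G.pAvg g x with hu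
  have hup : lpMem p u := hg.lpMem_sub_pAvg hne hp
  have hu0 : Tendsto u cofinite (𝓝 0) := by
    have h := hup.tendsto_cofinite_zero.rpow_const (p := 1 / p) (Or.inr (by positivity))
    rw [Real.zero_rpow (by positivity)] at h
    refine tendsto_zero_iff_abs_tendsto_zero _ |>.2 (h.congr fun x => ?_)
    rw [← Real.rpow_mul (abs_nonneg _), mul_one_div_cancel hp.ne', Real.rpow_one]
    rfl
  let K : ℝ≥0∞ := (∑' y, ‖u y‖ₑ ^ p) ^ (1 / p)
  have hKtop : K ≠ ⊤ := by
    refine ENNReal.rpow_ne_top_of_nonneg (by positivity) ?_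
    have h := hup.tsum_ofReal_ne_top
    convert h using 3 with y
    rw [← ENNReal.ofReal_rpow_of_nonneg (abs_nonneg _) hp.le, ← Real.enorm_eq_ofReal_abs]
  let a : ℕ → ℝ≥0∞ := fun i => (⨆ x : X, lpENorm q (G.walk i x)) * K
  have hatop : ∑' i, a i ≠ ⊤ := by
    rw [ENNReal.tsum_mul_right]
    exact ENNReal.mul_ne_top hsum hKtop
  have hasum : Summable fun i => (a i).toReal := ENNReal.summable_toReal hatop
  have hbound : ∀ i x, ‖G.avg i u x‖ ≤ (a i).toReal := by
    intro i x
    rw [← toReal_enorm]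
    refine ENNReal.toReal_mono (ENNReal.ne_top_of_tsum_ne_top hatop i) ?_
    exact (G.enorm_avg_le hq hpq i u x).trans
      (mul_le_mul_left (le_iSup (fun x => lpENorm q (G.walk i x)) x) K)
  have hval : ∀ x, ∑' i, G.avg i u x = g x - c := by
    intro x
    have h := (hasum.of_norm_bounded (fun i => hbound i x)).hasSum.tendsto_sum_nat
    refine tendsto_nhds_unique h ?_
    simp only [hu, sum_avg_sub_pAvg]
    exact (hbv x).const_sub (g x)
  have hlim : Tendsto (fun x => ∑' i, G.avg i u x) cofinite (𝓝 (∑' _ : ℕ, (0 : ℝ))) :=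
    tendsto_tsum_of_dominated_convergence hasum (G.avg_tendsto_cofinite hu0)
      (Eventually.of_forall fun x i => hbound i x)
  simp only [hval, tsum_zero] at hlim
  exact tendsto_sub_nhds_zero_iff.1 hlim

end LFGraph

/-- under uniform summability of the `ℓ^{p'}`-norms of the walk
distributions, a function of `D^p(Γ)` whose boundary value is constant has
trivial reduced `ℓ^p`-cohomology class. -/
theorem stmt15 {X : Type*} (G : LFGraph X) (hconn : G.Conn) (D : ℕ) (hval : G.BddVal D)
    (p : ℝ) (hp : 1 < p) (q : ℝ≥0∞) (hq : 1 / ENNReal.ofReal p + 1 / q = 1)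
    (hsum : ∑' i : ℕ, ⨆ x : X, lpENorm q (G.walk i x) ≠ ⊤)
    (e0 : X) (g : X → ℝ) (hg : G.MemDp p g)
    (c : ℝ) (hbv : ∀ x : X, Filter.Tendsto (fun n => G.avg n g x) Filter.atTop (nhds c)) :
    G.InClos p e0 g := by
  have hp0 : 0 < p := by linarith
  refine hg.inClos_of_tendsto_cofinite hp0 (c := c) ?_ e0
  rcases subsingleton_or_nontrivial X with _ | _
  · simp [Filter.cofinite_eq_bot]
  have hqtop : q ≠ ⊤ := by
    rintro rfl
    have hp1 : ENNReal.ofReal p = 1 := by simpa using hq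
    rw [ENNReal.ofReal_eq_one] at hp1
    exact hp.ne' hp1
  have hpq : p.HolderConjugate q.toReal := by
    rw [Real.holderConjugate_iff]
    refine ⟨hp, ?_⟩
    have h := congrArg ENNReal.toReal hq
    have hq0 : q ≠ 0 := by
      rintro rfl
      simp at hq
    rw [ENNReal.toReal_add (by simp [hp0]) (by simp [hq0])] at h
    simpa [hp0.le] using h
  exact hg.tendsto_cofinite hconn.nbr_nonempty hqtop hpq hsum hbv
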